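/- Every derivation from the generalized loop Witt algebra L to the tensor module V = L ⊗ L (adjoint diagonal action) is inner; equivalently, the first cohomology group H¹(L, L ⊗ L) vanishes. -/

import Mathlib

open Finsupp TensorProduct

/-- Bracket of the generalized loop Witt algebra `[L_{α,i},L_{β,j}] = (β−α)L_{α+β,i+j}`. -/
noncomputable def bk2 {F : Type*} [Field F] (Γ : AddSubgroup F) :
    ((Γ × ℤ) →₀ F) →ₗ[F] ((Γ × ℤ) →₀ F) →ₗ[F] ((Γ × ℤ) →₀ F) :=
  Finsupp.lsum F fun p => LinearMap.toSpanSingleton F _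
    (Finsupp.lsum F fun q =>
      (((q.1 : F) - (p.1 : F)) • Finsupp.lsingle (p.1 + q.1, p.2 + q.2) : F →ₗ[F] _))

/-- Diagonal adjoint action of `L` on `V = L ⊗ L`. -/
noncomputable def act {F : Type*} [Field F] (Γ : AddSubgroup F) (x : (Γ × ℤ) →₀ F) :
    (((Γ × ℤ) →₀ F) ⊗[F] ((Γ × ℤ) →₀ F)) →ₗ[F] (((Γ × ℤ) →₀ F) ⊗[F] ((Γ × ℤ) →₀ F)) :=
  LinearMap.rTensor _ (bk2 Γ x) + LinearMap.lTensor _ (bk2 Γ x)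

section core
variable {G A : Type*} [AddCommGroup G] [CommRing A]

/-- The action of the basis element `L_{a,i}` on functions `G × G → A`. -/
def XX (k : G →+ A) (T S : ℤ → A) (a : G) (i : ℤ) (f : G → G → A) (x y : G) : A :=
  k (x - a - a) * (T i * f (x - a) y) + k (y - a - a) * (S i * f x (y - a))

/-- cocycle condition -/
def Coc (k : G →+ A) (T S : ℤ → A) (d : G → ℤ → G → G → A) : Prop :=
  ∀ a b i j x y, k (b - a) * d (a + b) (i + j) x y
    = XX k T S a i (d b j) x y - XX k T S b j (d a i) x y

theorem coc_inner (k : G →+ A) (T S : ℤ → A) (hT : ∀ i j, T (i + j) = T i * T j)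
    (hS : ∀ i j, S (i + j) = S i * S j) (v : G → G → A) :
    Coc k T S (fun a i => XX k T S a i v) := by
  intro a b i j x y
  have e1 : ∀ z : G, z - (a + b) = z - a - b := fun z => by abel
  have e2 : ∀ z : G, z - b - a = z - a - b := fun z => by abel
  simp only [XX, hT, hS, e1, e2, map_sub]
  ring

theorem core_zero [IsDomain A] [CharZero A] (k : G →+ A) (T S : ℤ → A)
    (hT : ∀ i j, T (i + j) = T i * T j)
    (hS : ∀ i j, S (i + j) = S i * S j) (hT0 : T 0 = 1) (hS0 : S 0 = 1) (hTS : T 1 ≠ S 1)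
    (hk : ∀ x, k x = 0 → x = 0) (e : G) (he : k e = 1)
    (d : G → ℤ → G → G → A) (hd : Coc k T S d)
    (h0 : ∀ i x y, ¬ (x = 0 ∧ y = 0) → d 0 i x y = 0) :
    ∃ c : A, ∀ a i x y, d a i x y = XX k T S a i (fun x y => by
      classical exact if x = 0 ∧ y = 0 then c else 0) x y := by
  classical
  have hk' : ∀ x, x ≠ 0 → k x ≠ 0 := fun x hx h => hx (hk x h)
  -- basic relation
  have B : ∀ a i j x y, k a * d a (i + j) x y = (k x * T i + k y * S i) * d a j x y
      - (k (x - a - a) * (T j * d 0 i (x - a) y) + k (y - a - a) * (S j * d 0 i x (y - a))) := by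
    intro a i j x y
    have := hd 0 a i j x y
    simp only [XX, sub_zero, zero_add] at this
    rw [this]; ring
  have TT : T 1 * T (-1) = 1 := by rw [← hT, ← hT0]; norm_num
  have SS : S 1 * S (-1) = 1 := by rw [← hS, ← hS0]; norm_num
  have van : ∀ a, a ≠ 0 → ∀ j x y, ¬ (x = a ∧ y = 0) → ¬ (x = 0 ∧ y = a) → d a j x y = 0 := by
    intro a ha j x y h1 h2
    have B' : ∀ i j, k a * d a (i + j) x y = (k x * T i + k y * S i) * d a j x y := by
      intro i j
      rw [B, h0 i (x - a) y (by rintro ⟨h, h'⟩; exact h1 ⟨sub_eq_zero.1 h, h'⟩),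
        h0 i x (y - a) (by rintro ⟨h, h'⟩; exact h2 ⟨h, sub_eq_zero.1 h'⟩)]
      ring
    by_contra hne
    have e0 := B' 0 j
    rw [hT0, hS0, zero_add] at e0
    have e1 : k a = k x + k y := by
      apply mul_right_cancel₀ hne; linear_combination e0
    have f1 := B' 1 j
    have f2 := B' (-1) (1 + j)
    rw [show (-1 : ℤ) + (1 + j) = j by ring] at f2
    have f3 : (k x * k y * (T 1 - S 1) ^ 2) * d a j x y = 0 := by
      rw [e1] at f1 f2
      have : (k x + k y) ^ 2 * d a j x y
          = (k x * T (-1) + k y * S (-1)) * ((k x * T 1 + k y * S 1) * d a j x y) := by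
        linear_combination (k x + k y) * f2 + (k x * T (-1) + k y * S (-1)) * f1
      have g : (k x * k y * (T 1 * S (-1) + S 1 * T (-1) - 2)) * d a j x y = 0 := by
        linear_combination -this - (k x ^ 2 * TT + k y ^ 2 * SS) * d a j x y
      linear_combination (T 1 * S 1) * g
        - k x * k y * d a j x y * (T 1 ^ 2 * SS + S 1 ^ 2 * TT)
    have f4 : k x * k y = 0 := by
      rcases mul_eq_zero.1 f3 with h | h
      · rcases mul_eq_zero.1 h with h | h
        · exact h
        · exact absurd (sub_eq_zero.1 (pow_eq_zero_iff (two_ne_zero)|>.1 h)) hTS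
      · exact absurd h hne
    have e2 : a = x + y := by
      apply sub_eq_zero.1; apply hk; rw [map_sub, map_add, e1, sub_self]
    rcases mul_eq_zero.1 f4 with h | h
    · have := hk _ h
      subst this
      exact h2 ⟨rfl, by rw [e2, zero_add]⟩
    · have := hk _ h
      subst this
      exact h1 ⟨by rw [e2, add_zero], rfl⟩
  -- values on the two special points
  have P : ∀ a, a ≠ 0 → ∀ i j, d a (i + j) 0 a = S i * d a j 0 a + S j * d 0 i 0 0 := by
    intro a ha i j
    apply mul_left_cancel₀ (hk' a ha)
    rw [B, h0 i (0 - a) a (by rintro ⟨_, h⟩; exact ha h)]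
    simp only [map_sub, map_zero, sub_self]; ring
  have Q : ∀ a, a ≠ 0 → ∀ i j, d a (i + j) a 0 = T i * d a j a 0 + T j * d 0 i 0 0 := by
    intro a ha i j
    apply mul_left_cancel₀ (hk' a ha)
    rw [B, h0 i a (0 - a) (by rintro ⟨h, _⟩; exact ha h)]
    simp only [map_sub, map_zero, sub_self]; ring
  have hne : ∀ x y, k x ≠ k y → x ≠ y := fun x y h h' => h (h' ▸ rfl)
  have he0 : e ≠ 0 := hne _ _ (by rw [he, map_zero]; exact one_ne_zero)
  have cS : ∀ i j, d 0 (i + j) 0 0 = S i * d 0 j 0 0 + S j * d 0 i 0 0 := by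
    intro i j
    have a1 := P e he0 (i + j) 0
    have a2 := P e he0 i j
    have a3 := P e he0 j 0
    rw [add_zero] at a1 a3
    rw [hS0] at a1 a3; rw [hS] at a1
    linear_combination -a1 + a2 + S i * a3
  have cT : ∀ i j, d 0 (i + j) 0 0 = T i * d 0 j 0 0 + T j * d 0 i 0 0 := by
    intro i j
    have a1 := Q e he0 (i + j) 0
    have a2 := Q e he0 i j
    have a3 := Q e he0 j 0
    rw [add_zero] at a1 a3
    rw [hT0] at a1 a3; rw [hT] at a1
    linear_combination -a1 + a2 + T i * a3
  have hTS' : T 1 - S 1 ≠ 0 := sub_ne_zero.2 hTS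
  have c1 : d 0 1 0 0 = 0 := by
    have : 2 * ((T 1 - S 1) * d 0 1 0 0) = 0 := by linear_combination cS 1 1 - cT 1 1
    simpa [hTS'] using this
  have c0 : ∀ i, d 0 i 0 0 = 0 := by
    intro i
    have : (T 1 - S 1) * d 0 i 0 0 = 0 := by
      linear_combination cS 1 i - cT 1 i + (S i - T i) * c1
    simpa [hTS'] using this
  have P' : ∀ a, a ≠ 0 → ∀ i, d a i 0 a = S i * d a 0 0 a := by
    intro a ha i
    have := P a ha i 0
    rwa [add_zero, c0, mul_zero, add_zero] at this
  have Q' : ∀ a, a ≠ 0 → ∀ i, d a i a 0 = T i * d a 0 a 0 := by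
    intro a ha i
    have := Q a ha i 0
    rwa [add_zero, c0, mul_zero, add_zero] at this
  have R : ∀ a b, a ≠ 0 → b ≠ 0 → a ≠ b → k a * d b 0 0 b = k b * d a 0 a 0 := by
    intro a b ha hb hab
    have h := hd a b 0 0 a b
    have z1 : d (a + b) (0 + 0) a b = 0 := by
      by_cases hs : a + b = 0
      · rw [hs]; exact h0 _ _ _ (fun h => ha h.1)
      · exact van _ hs _ _ _ (fun h => hb h.2) (fun h => ha h.1)
    have z2 : d b 0 a (b - a) = 0 := van _ hb _ _ _ (fun h => hab h.1) (fun h => ha h.1)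
    have z3 : d a 0 (a - b) b = 0 := van _ ha _ _ _ (fun h => hb h.2) (fun h => hab h.2.symm)
    simp only [XX, z1, z2, z3, hT0, hS0, sub_self, map_sub, map_zero] at h
    linear_combination h
  have k2 : k (e + e) = 2 := by rw [map_add, he]; norm_num
  have k3 : k (e + e + e) = 3 := by rw [map_add, k2, he]; norm_num
  have e20 : e + e ≠ 0 := hne _ _ (by rw [k2, map_zero]; exact two_ne_zero)
  have e30 : e + e + e ≠ 0 := hne _ _ (by rw [k3, map_zero]; norm_num)
  have q1 : ∀ a, a ≠ 0 → a ≠ e → d a 0 a 0 = k a * d e 0 0 e := by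
    intro a ha hae
    have := R a e ha he0 hae
    rw [he] at this; linear_combination -this
  have e2e : e + e ≠ e := hne _ _ (by rw [k2, he]; norm_num)
  have e3e : e + e + e ≠ e := hne _ _ (by rw [k3, he]; norm_num)
  have e32 : e + e + e ≠ e + e := hne _ _ (by rw [k3, k2]; norm_num)
  have p1 : ∀ a, a ≠ 0 → d a 0 0 a = k a * d e 0 0 e := by
    intro a ha
    by_cases h2 : e + e = a
    · have h := R _ a e30 ha (h2 ▸ e32)
      rw [q1 _ e30 e3e, k3] at h
      apply mul_left_cancel₀ (by norm_num : (3 : A) ≠ 0); linear_combination h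
    · have h := R _ a e20 ha h2
      rw [q1 _ e20 e2e, k2] at h
      apply mul_left_cancel₀ (by norm_num : (2 : A) ≠ 0); linear_combination h
  have q2 : ∀ a, a ≠ 0 → d a 0 a 0 = k a * d e 0 0 e := by
    intro a ha
    by_cases hae : a = e
    · subst hae
      have h := R _ _ ha e20 (Ne.symm e2e)
      rw [p1 _ e20, k2] at h
      apply mul_left_cancel₀ (by norm_num : (2 : A) ≠ 0); linear_combination -h
    · exact q1 a ha hae
  refine ⟨- d e 0 0 e, ?_⟩
  intro a i x y
  by_cases ha : a = 0
  · subst ha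
    have l : d 0 i x y = 0 := by
      by_cases h : x = 0 ∧ y = 0
      · rw [h.1, h.2, c0]
      · exact h0 _ _ _ h
    rw [l]
    simp only [XX, sub_zero]
    by_cases h : x = 0 ∧ y = 0
    · rw [h.1, h.2]; simp
    · simp [h]
  by_cases h1 : x = a ∧ y = 0
  · obtain ⟨rfl, rfl⟩ := h1
    rw [Q' _ ha, q2 _ ha]
    simp [XX, ha]; ring
  by_cases h2 : x = 0 ∧ y = a
  · obtain ⟨rfl, rfl⟩ := h2
    rw [P' _ ha, p1 _ ha]
    simp [XX, ha]; ring
  rw [van _ ha _ _ _ h1 h2]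
  simp [XX, sub_eq_zero, h1, h2]

theorem core1 [IsDomain A] [CharZero A] (k : G →+ A) (T S : ℤ → A)
    (hT : ∀ i j, T (i + j) = T i * T j)
    (hS : ∀ i j, S (i + j) = S i * S j) (hT0 : T 0 = 1) (hS0 : S 0 = 1) (hTS : T 1 ≠ S 1)
    (u : G → A) (hu : ∀ x, x ≠ 0 → u x * k x = 1) (e : G) (he : k e = 1)
    (d : G → ℤ → G → G → A) (hd : Coc k T S d)
    (hfin : ∀ a i, {p : G × G | d a i p.1 p.2 ≠ 0}.Finite) :
    ∃ v : G → G → A, {p : G × G | v p.1 p.2 ≠ 0}.Finite ∧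
      ∀ a i x y, (T 1 - S 1) * d a i x y = XX k T S a i v x y := by
  classical
  have hk : ∀ x, k x = 0 → x = 0 := by
    intro x hx; by_contra h
    have := hu x h; rw [hx, mul_zero] at this; exact zero_ne_one this
  let v : G → G → A := fun x y => if x + y = 0 then (if x = 0 then 0 else u x * d 0 1 x y)
    else (T 1 - S 1) * (u (x + y) * d 0 0 x y)
  let d' : G → ℤ → G → G → A := fun a i x y => (T 1 - S 1) * d a i x y - XX k T S a i v x y
  have hd' : Coc k T S d' := by
    intro a b i j x y
    have h1 := hd a b i j x y
    have h2 := coc_inner k T S hT hS v a b i j x y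
    simp only [d']
    simp only [XX] at h1 h2 ⊢
    linear_combination (T 1 - S 1) * h1 - h2
  have C : ∀ i j x y, (k x * T i + k y * S i) * d 0 j x y
      = (k x * T j + k y * S j) * d 0 i x y := by
    intro i j x y
    have := hd 0 0 i j x y
    simp only [XX, sub_zero, map_zero] at this
    linear_combination -this
  have h0 : ∀ i x y, ¬ (x = 0 ∧ y = 0) → d' 0 i x y = 0 := by
    intro i x y hxy
    simp only [d', XX, sub_zero, v]
    by_cases hs : x + y = 0
    · have hx : x ≠ 0 := by
        rintro rfl; exact hxy ⟨rfl, by simpa using hs⟩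
      simp only [hs, if_true, hx, if_false]
      have hy : k y = - k x := by
        rw [eq_neg_iff_add_eq_zero, ← map_add, add_comm, hs, map_zero]
      have c := C 1 i x y
      rw [hy] at c ⊢
      linear_combination u x * c - (T 1 - S 1) * d 0 i x y * hu x hx
    · simp only [hs, if_false]
      have c := C 0 i x y
      rw [hT0, hS0] at c
      have := hu _ hs
      rw [map_add] at this
      linear_combination (T 1 - S 1) * u (x + y) * c - (T 1 - S 1) * d 0 i x y * this
  obtain ⟨c, hc⟩ := core_zero k T S hT hS hT0 hS0 hTS hk e he d' hd' h0
  refine ⟨fun x y => v x y + if x = 0 ∧ y = 0 then c else 0, ?_, ?_⟩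
  · refine (((hfin 0 0).union (hfin 0 1)).union (Set.finite_singleton (0, 0))).subset ?_
    rintro ⟨x, y⟩ h
    by_contra hn
    simp only [Set.mem_union, Set.mem_ofPred_eq, Set.mem_singleton_iff, Prod.mk.injEq, not_or,
      not_not] at hn
    apply h
    simp [v, hn.1.1, hn.1.2, hn.2]
  · intro a i x y
    have := hc a i x y
    simp only [d', XX] at this ⊢
    linear_combination this

theorem core [IsDomain A] [CharZero A] (k : G →+ A) (T S : ℤ → A)
    (hT : ∀ i j, T (i + j) = T i * T j)
    (hS : ∀ i j, S (i + j) = S i * S j) (hT0 : T 0 = 1) (hS0 : S 0 = 1) (hTS : T 1 ≠ S 1)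
    (u : G → A) (hu : ∀ x, x ≠ 0 → u x * k x = 1) (e : G) (he : k e = 1)
    (d : G → ℤ → G → G → A) (hd : Coc k T S d)
    (hfin : ∀ a i, {p : G × G | d a i p.1 p.2 ≠ 0}.Finite) :
    ∃ v : G → G → A, {p : G × G | v p.1 p.2 ≠ 0}.Finite ∧
      ∀ a i x y, d a i x y = XX k T S a i v x y := by
  classical
  obtain ⟨v, hv, h⟩ := core1 k T S hT hS hT0 hS0 hTS u hu e he d hd hfin
  have hTS' : T 1 - S 1 ≠ 0 := sub_ne_zero.2 hTS
  have hinf : Infinite G := by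
    refine Infinite.of_injective (fun n : ℕ => n • e) ?_
    intro m n hmn
    have := congrArg k hmn
    simpa [he] using this
  have dv : ∀ x y, ∃ w, v x y = (T 1 - S 1) * w := by
    intro x y
    have hf : ({a : G | v (x - a) (y + a) ≠ 0} ∪ {a | y - a = 0}).Finite := by
      refine Set.Finite.union ?_ ?_
      · refine Set.Finite.of_finite_image (f := fun a => (x - a, y + a)) (hv.subset ?_) ?_
        · rintro _ ⟨a, ha, rfl⟩; exact ha
        · intro a _ b _ hab
          simpa using (Prod.ext_iff.1 hab).2
      · refine (Set.finite_singleton y).subset ?_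
        intro a ha; exact (sub_eq_zero.1 ha).symm
    obtain ⟨a, ha⟩ := hf.infinite_compl.nonempty
    simp only [Set.mem_compl_iff, Set.mem_union, Set.mem_ofPred_eq, not_or, not_not] at ha
    have hh := h a 0 x (y + a)
    simp only [XX, ha.1, hT0, hS0, add_sub_cancel_right] at hh
    refine ⟨u (y - a) * d a 0 x (y + a), ?_⟩
    linear_combination -v x y * hu _ ha.2 - u (y - a) * hh
  choose w hw using dv
  refine ⟨w, ?_, ?_⟩
  · refine hv.subset ?_
    rintro ⟨x, y⟩ hxy
    simp only [Set.mem_ofPred_eq] at hxy ⊢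
    rw [hw]; exact mul_ne_zero hTS' hxy
  · intro a i x y
    apply mul_left_cancel₀ hTS'
    rw [h]
    simp only [XX, hw]; ring

end core

section bridge
variable {F : Type*} [Field F] (Γ : AddSubgroup F)

/-- identification of `L ⊗ L` with finitely supported functions to Laurent polynomials -/
noncomputable def PhiEquiv :
    (((Γ × ℤ) →₀ F) ⊗[F] ((Γ × ℤ) →₀ F)) ≃ₗ[F] ((Γ × Γ) →₀ AddMonoidAlgebra F (ℤ × ℤ)) :=
  finsuppTensorFinsupp' F (Γ × ℤ) (Γ × ℤ) ≪≫ₗ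
    Finsupp.domLCongr (Equiv.prodProdProdComm Γ ℤ Γ ℤ) ≪≫ₗ
    Finsupp.curryLinearEquiv F ≪≫ₗ
    Finsupp.mapRange.linearEquiv (AddMonoidAlgebra.coeffLinearEquiv F).symm

theorem PhiEquiv_single (p q : Γ × ℤ) (a b : F) :
    PhiEquiv Γ (Finsupp.single p a ⊗ₜ Finsupp.single q b)
      = Finsupp.single (p.1, q.1) (AddMonoidAlgebra.single (p.2, q.2) (a * b)) := by
  simp only [PhiEquiv, LinearEquiv.trans_apply, finsuppTensorFinsupp'_single_tmul_single,
    Finsupp.domLCongr_single, Equiv.prodProdProdComm_apply]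
  change Finsupp.mapRange _ (map_zero (AddMonoidAlgebra.coeffLinearEquiv F).symm)
    (Finsupp.curry _) = _
  rw [Finsupp.curry_single, Finsupp.mapRange_single]
  rfl

theorem bk2_single (p q : Γ × ℤ) (b : F) :
    bk2 Γ (Finsupp.single p 1) (Finsupp.single q b)
      = Finsupp.single (p.1 + q.1, p.2 + q.2) (((q.1 : F) - (p.1 : F)) * b) := by
  simp [bk2]

noncomputable def kk : Γ →+ AddMonoidAlgebra F (ℤ × ℤ) :=
  (algebraMap F (AddMonoidAlgebra F (ℤ × ℤ))).toAddMonoidHom.comp Γ.subtype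

noncomputable def TT (i : ℤ) : AddMonoidAlgebra F (ℤ × ℤ) := AddMonoidAlgebra.single (i, 0) 1
noncomputable def SS (i : ℤ) : AddMonoidAlgebra F (ℤ × ℤ) := AddMonoidAlgebra.single (0, i) 1

theorem kk_mul (x : Γ) (n : ℤ × ℤ) (b : F) :
    kk Γ x * AddMonoidAlgebra.single n b = AddMonoidAlgebra.single n ((x : F) * b) := by
  simp [kk, AddMonoidAlgebra.single_mul_single]

theorem XX_add (k : Γ →+ AddMonoidAlgebra F (ℤ × ℤ)) (T S) (a : Γ) (i : ℤ)
    (f g : (Γ × Γ) →₀ AddMonoidAlgebra F (ℤ × ℤ)) (x y : Γ) :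
    XX k T S a i (fun x y => (f + g) (x, y)) x y
      = XX k T S a i (fun x y => f (x, y)) x y + XX k T S a i (fun x y => g (x, y)) x y := by
  simp only [XX, Finsupp.add_apply]; ring

theorem Phi_act (p : Γ × ℤ) (v) (x y : Γ) :
    PhiEquiv Γ (act Γ (Finsupp.single p 1) v) (x, y)
      = XX (kk Γ) TT SS p.1 p.2 (fun x y => PhiEquiv Γ v (x, y)) x y := by
  classical
  induction v using TensorProduct.induction_on with
  | zero => simp [XX]
  | add u w hu hw => rw [map_add, map_add, map_add, XX_add, Finsupp.add_apply, hu, hw]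
  | tmul f g =>
    induction f using Finsupp.induction_linear with
    | zero => simp [XX]
    | add u w hu hw =>
      rw [TensorProduct.add_tmul, map_add, map_add, map_add, XX_add, Finsupp.add_apply, hu, hw]
    | single q a =>
      induction g using Finsupp.induction_linear with
      | zero => simp [XX]
      | add u w hu hw =>
        rw [TensorProduct.tmul_add, map_add, map_add, map_add, XX_add, Finsupp.add_apply, hu, hw]
      | single r b =>
        simp only [act, LinearMap.add_apply, LinearMap.rTensor_tmul, LinearMap.lTensor_tmul,
          bk2_single, map_add, PhiEquiv_single, Finsupp.add_apply, XX]
        simp only [Finsupp.single_apply, Prod.mk.injEq]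
        congr 1
        · by_cases h : q.1 = x - p.1 ∧ r.1 = y
          · have h' : p.1 + q.1 = x ∧ r.1 = y := ⟨by rw [h.1]; abel, h.2⟩
            rw [if_pos h, if_pos h', ← h.1, TT, AddMonoidAlgebra.single_mul_single, kk_mul]
            simp [mul_assoc]
          · have h' : ¬ (p.1 + q.1 = x ∧ r.1 = y) := by
              rintro ⟨h1, h2⟩; exact h ⟨by rw [← h1]; abel, h2⟩
            rw [if_neg h, if_neg h']; simp
        · by_cases h : q.1 = x ∧ r.1 = y - p.1
          · have h' : q.1 = x ∧ p.1 + r.1 = y := ⟨h.1, by rw [h.2]; abel⟩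
            rw [if_pos h, if_pos h', ← h.2, SS, AddMonoidAlgebra.single_mul_single, kk_mul]
            simp [mul_left_comm]
          · have h' : ¬ (q.1 = x ∧ p.1 + r.1 = y) := by
              rintro ⟨h1, h2⟩; exact h ⟨h1, by rw [← h2]; abel⟩
            rw [if_neg h, if_neg h']; simp

theorem act_add (x y : (Γ × ℤ) →₀ F) (v) : act Γ (x + y) v = act Γ x v + act Γ y v := by
  simp only [act, map_add, LinearMap.add_apply, LinearMap.rTensor_add, LinearMap.lTensor_add]
  abel

theorem act_smul (c : F) (x : (Γ × ℤ) →₀ F) (v) : act Γ (c • x) v = c • act Γ x v := by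
  simp only [act, map_smul, LinearMap.add_apply, LinearMap.rTensor_smul, LinearMap.lTensor_smul,
    LinearMap.smul_apply, smul_add]

end bridge

/-- every derivation from the generalized loop Witt algebra `L` to
`V = L ⊗ L` is inner, i.e. `H¹(L, L ⊗ L) = 0`. -/
theorem loop_witt_derivation_inner
    {F : Type*} [Field F] [CharZero F] (Γ : AddSubgroup F) (h1 : (1 : F) ∈ Γ)
    (D : ((Γ × ℤ) →₀ F) →ₗ[F] (((Γ × ℤ) →₀ F) ⊗[F] ((Γ × ℤ) →₀ F)))
    (hD : ∀ x y, D (bk2 Γ x y) = act Γ x (D y) - act Γ y (D x)) :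
    ∃ v : ((Γ × ℤ) →₀ F) ⊗[F] ((Γ × ℤ) →₀ F), ∀ x, D x = act Γ x v := by
  classical
  have : IsDomain (AddMonoidAlgebra F (ℤ × ℤ)) := NoZeroDivisors.to_isDomain _
  have : CharZero (AddMonoidAlgebra F (ℤ × ℤ)) :=
    charZero_of_injective_algebraMap (R := F) (algebraMap F _).injective
  obtain ⟨v, hv, h⟩ := core (kk Γ) TT SS
    (fun i j => by simp [TT, AddMonoidAlgebra.single_mul_single])
    (fun i j => by simp [SS, AddMonoidAlgebra.single_mul_single])
    rfl rfl
    (by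
      intro h
      have := AddMonoidAlgebra.single_left_injective (one_ne_zero (α := F)) h
      simp at this)
    (fun x => algebraMap F _ ((x : F)⁻¹))
    (by
      intro x hx
      have hx' : (x : F) ≠ 0 := by simpa using hx
      change algebraMap F _ _ * algebraMap F _ _ = 1
      rw [← map_mul]
      erw [inv_mul_cancel₀ hx', map_one])
    ⟨1, h1⟩ (map_one (algebraMap F _))
    (fun a i x y => PhiEquiv Γ (D (Finsupp.single (a, i) 1)) (x, y))
    (by
      intro a b i j x y
      have := congrArg (fun z => PhiEquiv Γ z (x, y))
        (hD (Finsupp.single (a, i) 1) (Finsupp.single (b, j) 1))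
      simp only [map_sub, Finsupp.sub_apply, Phi_act, bk2_single] at this
      rw [← smul_eq_mul, ← Finsupp.smul_single, map_smul, map_smul, Finsupp.smul_apply,
        Algebra.smul_def] at this
      exact this)
    (by
      intro a i
      refine (PhiEquiv Γ (D (Finsupp.single (a, i) 1))).hasFiniteSupport.subset ?_
      intro p hp; exact hp)
  refine ⟨(PhiEquiv Γ).symm (Finsupp.ofSupportFinite (fun p => v p.1 p.2) hv), ?_⟩
  intro x
  induction x using Finsupp.induction_linear with
  | zero =>
    have := act_smul Γ 0 0 ((PhiEquiv Γ).symm (Finsupp.ofSupportFinite (fun p => v p.1 p.2) hv))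
    rw [zero_smul, zero_smul] at this
    rw [this, map_zero]
  | add u w hu hw => rw [map_add, hu, hw, act_add]
  | single p c =>
    have e : Finsupp.single p c = c • Finsupp.single p (1 : F) := by simp
    rw [e, map_smul, act_smul]
    congr 1
    apply (PhiEquiv Γ).injective
    ext1 ⟨x, y⟩
    rw [Phi_act, LinearEquiv.apply_symm_apply]
    exact h p.1 p.2 x y
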